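/- Let 1 ≤ r ≤ n and let p be a size vector of length n with p_i ≥ 3 for all i ∈ [n]. If (A, B) is a maximal pair of r-cross-intersecting families in S_p such that A and B are not balls, then there exists a maximal pair (A', B') of r-cross-intersecting families in S_p such that A' and B' are monotone, A' and B' are not balls, and the number of coordinates relevant for A' is at most the number of coordinates relevant for A. -/

import Mathlib

open Finset

/-- Families `A`, `B` of vectors in `S_p` (modelled as `∀ i, Fin (p i)`, with
`[p i] = {1, …, p i}` identified with `Fin (p i) = {0, …, p i - 1}`) are
`r`-cross-intersecting: every `x ∈ A` and `y ∈ B` agree in at least `r`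
coordinates. -/
def CrossInt {n : ℕ} {p : Fin n → ℕ} (r : ℕ)
    (A B : Finset (∀ i, Fin (p i))) : Prop :=
  ∀ x ∈ A, ∀ y ∈ B, r ≤ (univ.filter (fun i => x i = y i)).card

/-- `(A, B)` is a maximal `r`-cross-intersecting pair. -/
def MaxPair {n : ℕ} {p : Fin n → ℕ} (r : ℕ)
    (A B : Finset (∀ i, Fin (p i))) : Prop :=
  CrossInt r A B ∧ ∀ A' B' : Finset (∀ i, Fin (p i)),
    CrossInt r A' B' → A'.card * B'.card ≤ A.card * B.card

/-- Coordinate `i` is relevant for `A`: some two vectors differing only in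
coordinate `i` are such that one belongs to `A` and the other one does not. -/
def Relevant {n : ℕ} {p : Fin n → ℕ} (A : Finset (∀ i, Fin (p i)))
    (i : Fin n) : Prop :=
  ∃ x y : ∀ j, Fin (p j), (∀ j, j ≠ i → x j = y j) ∧ x ∈ A ∧ y ∉ A

/-- The Hamming ball of radius `k` around `x₀` in the coordinates `T`. -/
def hBall {n : ℕ} {p : Fin n → ℕ} (T : Finset (Fin n))
    (x₀ : ∀ i, Fin (p i)) (k : ℕ) : Finset (∀ i, Fin (p i)) :=
  univ.filter (fun x => (T.filter (fun i => x i ≠ x₀ i)).card ≤ k)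

/-- `A` is a ball: a Hamming ball of some radius around some vector in some
set of coordinates. -/
def IsBall {n : ℕ} {p : Fin n → ℕ} (A : Finset (∀ i, Fin (p i))) : Prop :=
  ∃ (T : Finset (Fin n)) (x₀ : ∀ i, Fin (p i)) (k : ℕ), A = hBall T x₀ k

/-- The support of a vector `x`: the set of coordinates where `x_i > 1`
(i.e. where `x i` is not the least element `0` of `Fin (p i)`). -/
def suppv {n : ℕ} {p : Fin n → ℕ} (x : ∀ i, Fin (p i)) : Finset (Fin n) :=
  univ.filter (fun i => 0 < (x i : ℕ))

/-- A family `A ⊆ S_p` is monotone if `x ∈ A`, `y ∈ S_p` and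
`supp(y) ⊆ supp(x)` imply `y ∈ A`. -/
def MonotoneFam {n : ℕ} {p : Fin n → ℕ} (A : Finset (∀ i, Fin (p i))) : Prop :=
  ∀ x ∈ A, ∀ y : ∀ i, Fin (p i), suppv y ⊆ suppv x → y ∈ A


namespace Sol

variable {n : ℕ} {p : Fin n → ℕ}

/-- swap the values `a` and `b` in coordinate `i` -/
def sw (i : Fin n) (a b : Fin (p i)) (x : ∀ i, Fin (p i)) : ∀ i, Fin (p i) :=
  Function.update x i (Equiv.swap a b (x i))

theorem sw_sw (i : Fin n) (a b : Fin (p i)) (x : ∀ i, Fin (p i)) :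
    sw i a b (sw i a b x) = x := by
  simp [sw]

theorem sw_same (i : Fin n) (a b : Fin (p i)) (x : ∀ i, Fin (p i)) :
    sw i a b x i = Equiv.swap a b (x i) := by
  simp [sw]

theorem sw_ne (i : Fin n) (a b : Fin (p i)) (x : ∀ i, Fin (p i)) {j : Fin n} (h : j ≠ i) :
    sw i a b x j = x j := by
  simp [sw, h]

theorem sw_of_ne (i : Fin n) (a b : Fin (p i)) (x : ∀ i, Fin (p i)) (ha : x i ≠ a)
    (hb : x i ≠ b) : sw i a b x = x := by
  simp [sw, Equiv.swap_apply_of_ne_of_ne ha hb]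

/-- the shift from `b` to `a` in coordinate `i` -/
def sh (i : Fin n) (a b : Fin (p i)) (A : Finset (∀ i, Fin (p i))) :
    Finset (∀ i, Fin (p i)) :=
  univ.filter (fun x => (x ∈ A ∧ (x i = b → sw i a b x ∈ A)) ∨ (x i = a ∧ sw i a b x ∈ A))

theorem mem_sh {i : Fin n} {a b : Fin (p i)} {A : Finset (∀ i, Fin (p i))}
    {x : ∀ i, Fin (p i)} : x ∈ sh i a b A ↔
      (x ∈ A ∧ (x i = b → sw i a b x ∈ A)) ∨ (x i = a ∧ sw i a b x ∈ A) := by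
  simp [sh]

theorem sdiff_sh_val {i : Fin n} {a b : Fin (p i)} {A : Finset (∀ i, Fin (p i))}
    {x : ∀ i, Fin (p i)} (h : x ∈ A) (h' : x ∉ sh i a b A) :
    x i = b ∧ sw i a b x ∉ A := by
  rw [mem_sh] at h'
  tauto

theorem sum_sh {i : Fin n} {a b : Fin (p i)} (hab : a ≠ b) (A : Finset (∀ i, Fin (p i)))
    (w : (∀ i, Fin (p i)) → ℕ) :
    ∑ x ∈ sh i a b A \ A, w x = ∑ x ∈ A \ sh i a b A, w (sw i a b x) := by
  refine Finset.sum_bij' (fun x _ => sw i a b x) (fun x _ => sw i a b x) ?_ ?_ ?_ ?_ ?_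
  · intro x hx
    simp only [mem_sdiff, mem_sh] at hx ⊢
    obtain ⟨h1, h2⟩ := hx
    rcases h1 with h1 | ⟨h1, h3⟩
    · exact absurd h1.1 h2
    · refine ⟨h3, ?_⟩
      rw [sw_sw, sw_same, h1, Equiv.swap_apply_left]
      rintro (h | h)
      · exact h2 (h.2 rfl)
      · exact hab h.1.symm
  · intro x hx
    rw [mem_sdiff] at hx
    obtain ⟨h1, h2⟩ := hx
    obtain ⟨h3, h4⟩ := sdiff_sh_val h1 h2
    rw [mem_sdiff, mem_sh, sw_sw, sw_same, h3, Equiv.swap_apply_right]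
    exact ⟨Or.inr ⟨rfl, h1⟩, h4⟩
  · intro x _; exact sw_sw i a b x
  · intro x _; exact sw_sw i a b x
  · intro x _; simp [sw_sw]

theorem card_sh {i : Fin n} {a b : Fin (p i)} (hab : a ≠ b) (A : Finset (∀ i, Fin (p i))) :
    (sh i a b A).card = A.card := by
  have h := sum_sh hab A (fun _ => 1)
  simp only [sum_const, smul_eq_mul, mul_one] at h
  have h1 := Finset.card_sdiff_add_card_inter (sh i a b A) A
  have h2 := Finset.card_sdiff_add_card_inter A (sh i a b A)
  rw [inter_comm] at h2
  omega

theorem sum_sh_lt {i : Fin n} {a b : Fin (p i)} (hab : a ≠ b) (A : Finset (∀ i, Fin (p i)))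
    (w : (∀ i, Fin (p i)) → ℕ) (hw : ∀ x, x i = b → w (sw i a b x) < w x) :
    ∑ x ∈ sh i a b A, w x ≤ ∑ x ∈ A, w x ∧
    (sh i a b A ≠ A → ∑ x ∈ sh i a b A, w x < ∑ x ∈ A, w x) := by
  have h := sum_sh hab A w
  have h1 := Finset.sum_inter_add_sum_sdiff (sh i a b A) A w
  have h2 := Finset.sum_inter_add_sum_sdiff A (sh i a b A) w
  rw [inter_comm] at h2
  have h3 : ∑ x ∈ A \ sh i a b A, w (sw i a b x) ≤ ∑ x ∈ A \ sh i a b A, w x := by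
    refine Finset.sum_le_sum fun x hx => ?_
    rw [mem_sdiff] at hx
    exact (hw x (sdiff_sh_val hx.1 hx.2).1).le
  refine ⟨by omega, fun hne => ?_⟩
  have h4 : ∑ x ∈ A \ sh i a b A, w (sw i a b x) < ∑ x ∈ A \ sh i a b A, w x := by
    refine Finset.sum_lt_sum_of_nonempty ?_ fun x hx => ?_
    · rw [Finset.sdiff_nonempty]
      intro hs
      exact hne (Finset.eq_of_subset_of_card_le hs (card_sh hab A).le).symm
    · rw [mem_sdiff] at hx
      exact hw x (sdiff_sh_val hx.1 hx.2).1
  omega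

theorem agree_sw (i : Fin n) (a b : Fin (p i)) (x y : ∀ i, Fin (p i)) :
    (univ.filter (fun j => sw i a b x j = sw i a b y j)) =
      univ.filter (fun j => x j = y j) := by
  ext j
  simp only [mem_filter, mem_univ, true_and]
  by_cases h : j = i
  · subst h; simp [sw_same]
  · simp [sw_ne _ _ _ _ h]

theorem crossInt_symm {r : ℕ} {A B : Finset (∀ i, Fin (p i))} (h : CrossInt r A B) :
    CrossInt r B A := by
  intro x hx y hy
  have := h y hy x hx
  simpa only [eq_comm] using this

theorem maxPair_symm {r : ℕ} {A B : Finset (∀ i, Fin (p i))} (h : MaxPair r A B) :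
    MaxPair r B A := by
  refine ⟨crossInt_symm h.1, fun A' B' h' => ?_⟩
  have := h.2 B' A' (crossInt_symm h')
  rwa [mul_comm, mul_comm B.card]

theorem crossInt_sh_aux {r : ℕ} {i : Fin n} {a b : Fin (p i)}
    {A B : Finset (∀ i, Fin (p i))} (h : CrossInt r A B)
    {x y : ∀ i, Fin (p i)} (hx : x ∈ sh i a b A) (hy : y ∈ sh i a b B)
    (hxA : x ∈ A) (hyB : sw i a b y ∈ B) (hxA' : sw i a b x ∉ A) (hyB' : y ∉ B) :
    r ≤ (univ.filter (fun i => x i = y i)).card := by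
  rw [mem_sh] at hx hy
  have hya : y i = a := by tauto
  have hxb : x i ≠ b := by tauto
  have hxa : x i = a := by
    by_contra hxa
    exact hxA' (by rwa [sw_of_ne _ _ _ _ hxa hxb])
  refine (h x hxA _ hyB).trans (card_le_card ?_)
  intro j
  simp only [mem_filter, mem_univ, true_and]
  intro hj
  by_cases hji : j = i
  · subst hji; rw [hxa, hya]
  · rwa [sw_ne _ _ _ _ hji] at hj

theorem mem_or_of_mem_sh {i : Fin n} {a b : Fin (p i)} {A : Finset (∀ i, Fin (p i))}
    {x : ∀ i, Fin (p i)} (hx : x ∈ sh i a b A) : x ∈ A ∨ sw i a b x ∈ A := by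
  rw [mem_sh] at hx; tauto

theorem crossInt_sh {r : ℕ} {i : Fin n} {a b : Fin (p i)}
    {A B : Finset (∀ i, Fin (p i))} (h : CrossInt r A B) :
    CrossInt r (sh i a b A) (sh i a b B) := by
  intro x hx y hy
  by_cases h1 : x ∈ A ∧ y ∈ B
  · exact h x h1.1 y h1.2
  by_cases h2 : sw i a b x ∈ A ∧ sw i a b y ∈ B
  · have := h _ h2.1 _ h2.2
    rwa [agree_sw] at this
  have hx' := mem_or_of_mem_sh hx
  have hy' := mem_or_of_mem_sh hy
  by_cases h3 : x ∈ A
  · exact crossInt_sh_aux h hx hy h3 (by tauto) (by tauto) (by tauto)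
  · have := crossInt_sh_aux (crossInt_symm h) hy hx (by tauto) (by tauto) (by tauto) h3
    simpa only [eq_comm] using this

theorem maxPair_sh {r : ℕ} {i : Fin n} {a b : Fin (p i)} (hab : a ≠ b)
    {A B : Finset (∀ i, Fin (p i))} (h : MaxPair r A B) :
    MaxPair r (sh i a b A) (sh i a b B) := by
  refine ⟨crossInt_sh h.1, ?_⟩
  rw [card_sh hab, card_sh hab]
  exact h.2

theorem relevant_sh {i : Fin n} {a b : Fin (p i)}
    {A : Finset (∀ i, Fin (p i))} {k : Fin n} (h : Relevant (sh i a b A) k) :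
    Relevant A k := by
  by_contra hirr
  have key : ∀ x y : ∀ j, Fin (p j), (∀ j, j ≠ k → x j = y j) → (x ∈ A → y ∈ A) := by
    intro x y hxy hx
    by_contra hy
    exact hirr ⟨x, y, hxy, hx, hy⟩
  have key' : ∀ x y : ∀ j, Fin (p j), (∀ j, j ≠ k → x j = y j) → (x ∈ A ↔ y ∈ A) := by
    intro x y hxy
    exact ⟨key x y hxy, key y x fun j hj => (hxy j hj).symm⟩
  obtain ⟨x, y, hxy, hx, hy⟩ := h
  rw [mem_sh] at hx hy
  have h1 := key' x y hxy
  by_cases hki : k = i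
  · subst hki
    have h2 := key' x (sw k a b x) fun j hj => (sw_ne _ _ _ _ hj).symm
    have h3 := key' y (sw k a b y) fun j hj => (sw_ne _ _ _ _ hj).symm
    tauto
  · have h2 := key' (sw i a b x) (sw i a b y) (fun j hj => by
      by_cases hji : j = i
      · subst hji; rw [sw_same, sw_same, hxy _ hj]
      · rw [sw_ne _ _ _ _ hji, sw_ne _ _ _ _ hji, hxy _ hj])
    have h4 := hxy i (Ne.symm hki)
    rw [h4] at hx
    tauto

theorem maxPair_pos {r : ℕ} (hrn : r ≤ n) (x₀ : ∀ i, Fin (p i))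
    {A B : Finset (∀ i, Fin (p i))} (h : MaxPair r A B) : 0 < A.card ∧ 0 < B.card := by
  have := h.2 {x₀} {x₀} (by
    intro x hx y hy
    rw [mem_singleton] at hx hy
    subst hx; subst hy
    simpa using hrn)
  simp only [card_singleton, mul_one] at this
  exact ⟨Nat.pos_of_mul_pos_right this, Nat.pos_of_mul_pos_left this⟩

theorem saturated {r : ℕ} (hrn : r ≤ n)
    {A B : Finset (∀ i, Fin (p i))} (h : MaxPair r A B) (x : ∀ i, Fin (p i))
    (hx : ∀ y ∈ B, r ≤ (univ.filter (fun i => x i = y i)).card) : x ∈ A := by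
  by_contra hxA
  have hpos := maxPair_pos hrn x h
  have := h.2 (insert x A) B (by
    intro z hz y hy
    rw [mem_insert] at hz
    rcases hz with rfl | hz
    · exact hx y hy
    · exact h.1 z hz y hy)
  rw [card_insert_of_notMem hxA] at this
  have h2 := hpos.2
  nlinarith

/-- closure under resetting coordinates to the value of `z` -/
theorem closed_reset {A : Finset (∀ i, Fin (p i))} (z : ∀ i, Fin (p i))
    (h : ∀ i b, b ≠ z i → sh i (z i) b A = A) (U : Finset (Fin n)) :
    ∀ x ∈ A, (fun i => if i ∈ U then z i else x i) ∈ A := by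
  induction U using Finset.induction_on with
  | empty => intro x hx; simpa using hx
  | insert i U hi ih =>
    intro x hx
    have h1 := ih x hx
    set y : ∀ i, Fin (p i) := fun i => if i ∈ U then z i else x i with hy
    have h2 : (fun k => if k ∈ insert i U then z k else x k) = Function.update y i (z i) := by
      ext k
      by_cases hk : k = i
      · subst hk; simp
      · simp [hk, hy]
    rw [h2]
    by_cases h3 : y i = z i
    · rw [← h3, Function.update_eq_self]; exact h1
    · have h4 := h i (y i) h3
      rw [← h4, mem_sh] at h1
      have h5 : sw i (z i) (y i) y = Function.update y i (z i) := by
        simp [sw]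
      rw [h5] at h1
      tauto

theorem monotone_of_closed {r : ℕ} (hrn : r ≤ n)
    {A B : Finset (∀ i, Fin (p i))} (h : MaxPair r A B) (z : ∀ i, Fin (p i))
    (hz : ∀ i, (z i : ℕ) = 0)
    (hB : ∀ i b, b ≠ z i → sh i (z i) b B = B) : MonotoneFam A := by
  intro x hx y hxy
  refine saturated hrn h y fun v hv => ?_
  have h1 := closed_reset z hB (univ.filter fun i => x i ≠ z i ∧ x i = v i) v hv
  refine (h.1 x hx _ h1).trans (card_le_card ?_)
  intro i
  simp only [mem_filter, mem_univ, true_and]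
  intro hi
  split_ifs at hi with h2
  · exact absurd hi h2.1
  · have h3 : x i = z i := by tauto
    have h4 : i ∉ suppv x := by simp [suppv, h3, hz]
    have h5 : i ∉ suppv y := fun h => h4 (hxy h)
    have h6 : (y i : ℕ) = 0 := by simpa [suppv] using h5
    rw [← hi, h3]
    exact Fin.ext (by rw [h6, hz])


/-- Hamming distance in the coordinates `T` -/
def dd (T : Finset (Fin n)) (x₀ x : ∀ i, Fin (p i)) : ℕ :=
  (T.filter (fun i => x i ≠ x₀ i)).card

theorem mem_hBall {T : Finset (Fin n)} {x₀ x : ∀ i, Fin (p i)} {k : ℕ} :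
    x ∈ hBall T x₀ k ↔ dd T x₀ x ≤ k := by
  simp [hBall, dd]

theorem dd_add (T : Finset (Fin n)) (x₀ x : ∀ i, Fin (p i)) :
    (T.filter (fun i => x i = x₀ i)).card + dd T x₀ x = T.card := by
  exact Finset.card_filter_add_card_filter_not _

theorem crossInt_balls {r k l : ℕ} {T : Finset (Fin n)} (x₀ : ∀ i, Fin (p i))
    (h : k + l + r ≤ T.card) : CrossInt r (hBall T x₀ k) (hBall T x₀ l) := by
  intro x hx y hy
  rw [mem_hBall] at hx hy
  have h1 : T \ (T.filter (fun i => x i ≠ x₀ i) ∪ T.filter (fun i => y i ≠ x₀ i)) ⊆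
      univ.filter (fun i => x i = y i) := by
    intro i
    simp only [mem_sdiff, mem_union, mem_filter, mem_univ, true_and]
    rintro ⟨h1, h2⟩
    have h3 : x i = x₀ i := by tauto
    have h4 : y i = x₀ i := by tauto
    rw [h3, h4]
  have h2 := card_le_card h1
  have h3 := Finset.le_card_sdiff
    (T.filter (fun i => x i ≠ x₀ i) ∪ T.filter (fun i => y i ≠ x₀ i)) T
  have h4 := Finset.card_union_le (T.filter (fun i => x i ≠ x₀ i))
    (T.filter (fun i => y i ≠ x₀ i))
  unfold dd at hx hy
  omega

theorem exists_ne2 (hp : ∀ i, 3 ≤ p i) (i : Fin n) (u v : Fin (p i)) :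
    ∃ w : Fin (p i), w ≠ u ∧ w ≠ v := by
  have h : ((univ : Finset (Fin (p i))) \ {u, v}).Nonempty := by
    rw [← card_pos]
    have h1 := Finset.le_card_sdiff ({u, v} : Finset (Fin (p i))) univ
    have h2 := Finset.card_le_two (a := u) (b := v)
    rw [card_univ, Fintype.card_fin] at h1
    have := hp i
    omega
  obtain ⟨w, hw⟩ := h
  simp at hw
  exact ⟨w, hw⟩

theorem ball_partner {r k : ℕ} (hr : 1 ≤ r) (hrn : r ≤ n) (hp : ∀ i, 3 ≤ p i)
    {B : Finset (∀ i, Fin (p i))} {T : Finset (Fin n)} {x₀ : ∀ i, Fin (p i)}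
    (h : MaxPair r (hBall T x₀ k) B) :
    ∃ l, k + l + r = T.card ∧ B = hBall T x₀ l := by
  have hpos := (maxPair_pos hrn x₀ h).2
  have key : ∀ y ∈ B, k + r ≤ (T.filter (fun i => y i = x₀ i)).card := by
    intro y hy
    by_contra hlt
    push Not at hlt
    set E := T.filter (fun i => y i = x₀ i) with hE
    obtain ⟨K, hKE, hK⟩ := Finset.exists_subset_card_eq (s := E) (n := min k E.card)
      (min_le_right _ _)
    choose o ho using fun i => exists_ne2 hp i (y i) (y i)
    let x : ∀ i, Fin (p i) := fun i => if i ∈ T ∧ i ∉ K then x₀ i else o i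
    have hx : x ∈ hBall T x₀ k := by
      rw [mem_hBall]
      refine le_trans (card_le_card (t := K) ?_) (hK.le.trans (min_le_left _ _))
      intro i
      simp only [mem_filter]
      rintro ⟨h1, h2⟩
      by_contra h3
      exact h2 (by simp [x, h1, h3])
    have h1 := h.1 x hx y hy
    have h2 : univ.filter (fun i => x i = y i) ⊆ E \ K := by
      intro i
      simp only [mem_filter, mem_univ, true_and, mem_sdiff, hE, x]
      intro hi
      split_ifs at hi with h3
      · exact ⟨⟨h3.1, hi.symm⟩, h3.2⟩
      · exact absurd hi (ho i).1
    have h3 := card_le_card h2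
    rw [card_sdiff_of_subset hKE, hK] at h3
    omega
  obtain ⟨y₀, hy₀⟩ := card_pos.mp hpos
  have h1 := key y₀ hy₀
  have h2 := dd_add T x₀ y₀
  refine ⟨T.card - (k + r), by omega, ?_⟩
  ext y
  rw [mem_hBall]
  constructor
  · intro hy
    have h3 := key y hy
    have h4 := dd_add T x₀ y
    omega
  · intro hy
    refine saturated hrn (maxPair_symm h) y fun x hx => ?_
    exact crossInt_balls (r := r) (l := k) (k := T.card - (k + r)) x₀ (by omega) y
      (mem_hBall.mpr hy) x hx

theorem card_coord {C : Finset (∀ i, Fin (p i))} (j : Fin n) (v : Fin (p j))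
    (hC : ∀ x ∈ C, ∀ u, Function.update x j u ∈ C) :
    p j * (C.filter (fun x => x j = v)).card = C.card := by
  have h := Finset.card_eq_sum_card_fiberwise (s := C) (t := univ) (f := fun x => x j)
    (fun _ _ => by simp)
  have h2 : ∀ u ∈ (univ : Finset (Fin (p j))), (C.filter (fun x => x j = u)).card =
      (C.filter (fun x => x j = v)).card := by
    intro u _
    refine Finset.card_bij' (fun x _ => Function.update x j v) (fun x _ => Function.update x j u)
      ?_ ?_ ?_ ?_
    · intro x hx
      simp only [mem_filter] at hx ⊢
      exact ⟨hC x hx.1 v, by simp⟩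
    · intro x hx
      simp only [mem_filter] at hx ⊢
      exact ⟨hC x hx.1 u, by simp⟩
    · intro x hx
      simp only [mem_filter] at hx
      simp [← hx.2]
    · intro x hx
      simp only [mem_filter] at hx
      simp [← hx.2]
  rw [Finset.sum_congr rfl h2] at h
  simpa using h.symm

/-- the shell at distance exactly `k` -/
def shell (T : Finset (Fin n)) (x₀ : ∀ i, Fin (p i)) (k : ℕ) : Finset (∀ i, Fin (p i)) :=
  univ.filter (fun x => dd T x₀ x = k)

theorem mem_shell {T : Finset (Fin n)} {x₀ x : ∀ i, Fin (p i)} {k : ℕ} :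
    x ∈ shell T x₀ k ↔ dd T x₀ x = k := by simp [shell]

theorem dd_erase {T : Finset (Fin n)} {i : Fin n} (hi : i ∈ T) (x₀ x : ∀ i, Fin (p i)) :
    dd T x₀ x = dd (T.erase i) x₀ x + if x i = x₀ i then 0 else 1 := by
  unfold dd
  conv_lhs => rw [← Finset.insert_erase hi]
  rw [Finset.filter_insert]
  by_cases h : x i = x₀ i
  · simp [h]
  · rw [if_pos h, if_neg h, card_insert_of_notMem (by simp)]

theorem dd_congr {T : Finset (Fin n)} {x₀ x y : ∀ i, Fin (p i)}
    (h : ∀ i ∈ T, x i = y i) : dd T x₀ x = dd T x₀ y := by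
  unfold dd
  congr 1
  refine Finset.filter_congr fun i hi => ?_
  rw [h i hi]

theorem dd_update {T : Finset (Fin n)} {i : Fin n} (hi : i ∉ T) (x₀ x : ∀ i, Fin (p i))
    (u : Fin (p i)) : dd T x₀ (Function.update x i u) = dd T x₀ x := by
  refine dd_congr fun j hj => ?_
  have : j ≠ i := by rintro rfl; exact hi hj
  simp [this]

theorem shell_nonempty (hp : ∀ i, 3 ≤ p i) {T : Finset (Fin n)} (x₀ : ∀ i, Fin (p i)) {k : ℕ}
    (h : k ≤ T.card) : 0 < (shell T x₀ k).card := by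
  obtain ⟨K, hKT, hK⟩ := Finset.exists_subset_card_eq h
  choose o ho using fun i => exists_ne2 hp i (x₀ i) (x₀ i)
  refine card_pos.mpr ⟨fun i => if i ∈ K then o i else x₀ i, ?_⟩
  rw [mem_shell, ← hK]
  unfold dd
  congr 1
  ext i
  simp only [mem_filter]
  constructor
  · rintro ⟨h1, h2⟩
    by_contra h3
    simp [h3] at h2
  · intro hi
    refine ⟨hKT hi, ?_⟩
    simp [hi, (ho i).1]

theorem shell_ineq {T : Finset (Fin n)} (x₀ : ∀ i, Fin (p i)) {M : ℕ}
    (hM : ∀ j ∈ T, p j ≤ M) (k s : ℕ) (hks : k + s = T.card) :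
    (k + 1) * (shell T x₀ (k + 1)).card ≤ s * ((M - 1) * (shell T x₀ k).card) := by
  have h1 : (k + 1) * (shell T x₀ (k + 1)).card =
      ∑ j ∈ T, ((shell T x₀ (k + 1)).filter (fun x => x j ≠ x₀ j)).card := by
    have := Finset.sum_card_bipartiteAbove_eq_sum_card_bipartiteBelow
      (s := shell T x₀ (k + 1)) (t := T) (fun x j => x j ≠ x₀ j)
    unfold Finset.bipartiteAbove Finset.bipartiteBelow at this
    rw [← this, mul_comm, ← smul_eq_mul, ← Finset.sum_const]
    refine Finset.sum_congr rfl fun x hx => ?_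
    exact (mem_shell.mp hx).symm
  have h2 : s * (shell T x₀ k).card =
      ∑ j ∈ T, ((shell T x₀ k).filter (fun x => x j = x₀ j)).card := by
    have := Finset.sum_card_bipartiteAbove_eq_sum_card_bipartiteBelow
      (s := shell T x₀ k) (t := T) (fun x j => x j = x₀ j)
    unfold Finset.bipartiteAbove Finset.bipartiteBelow at this
    rw [← this, mul_comm, ← smul_eq_mul, ← Finset.sum_const]
    refine Finset.sum_congr rfl fun x hx => ?_
    have h3 := dd_add T x₀ x
    rw [mem_shell.mp hx] at h3
    show s = (T.filter (fun i => x i = x₀ i)).card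
    omega
  rw [h1, mul_left_comm, h2, Finset.mul_sum]
  refine Finset.sum_le_sum fun j hj => ?_
  refine Finset.card_le_mul_card_image_of_maps_to
    (f := fun x => Function.update x j (x₀ j)) ?_ _ ?_
  · intro x hx
    simp only [mem_shell, mem_filter] at hx ⊢
    refine ⟨?_, by simp⟩
    have h3 := dd_erase hj x₀ x
    have h4 := dd_erase hj x₀ (Function.update x j (x₀ j))
    rw [dd_update (T := T.erase j) (notMem_erase j T)] at h4
    rw [if_neg hx.2] at h3
    rw [if_pos (by simp)] at h4
    have h5 := hx.1
    omega
  · intro y _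
    have h5 : (univ.erase (x₀ j)).card ≤ M - 1 := by
      rw [card_erase_of_mem (mem_univ _), card_univ, Fintype.card_fin]
      have := hM j hj
      omega
    refine le_trans (Finset.card_le_card_of_injOn (fun x => x j) ?_ ?_) h5
    · intro x hx
      simp only [coe_filter, Set.mem_ofPred_eq, mem_filter] at hx
      simpa using hx.1.2
    · intro x hx x' hx' hxx
      simp only [coe_filter, Set.mem_ofPred_eq, mem_filter] at hx hx'
      have e := hx.2.trans hx'.2.symm
      funext i
      by_cases hi : i = j
      · subst hi; exact hxx
      · have := congrFun e i
        simpa [hi] using this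

theorem ball_card_succ {T : Finset (Fin n)} (x₀ : ∀ i, Fin (p i)) (k : ℕ) :
    (hBall T x₀ (k + 1)).card = (hBall T x₀ k).card + (shell T x₀ (k + 1)).card := by
  rw [← card_union_of_disjoint]
  · congr 1
    ext x
    simp only [mem_hBall, mem_union, mem_shell]
    omega
  · rw [Finset.disjoint_left]
    intro x
    simp only [mem_hBall, mem_shell]
    omega

theorem ball_card_erase {T : Finset (Fin n)} (x₀ : ∀ i, Fin (p i)) (k : ℕ) {i : Fin n}
    (hi : i ∈ T) :
    p i * (hBall T x₀ (k + 1)).card = p i * (hBall (T.erase i) x₀ k).card +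
      (shell (T.erase i) x₀ (k + 1)).card := by
  have h := card_coord (C := shell (T.erase i) x₀ (k + 1)) i (x₀ i) (by
    intro x hx u
    rw [mem_shell] at hx ⊢
    rw [dd_update (by simp), hx])
  rw [← h, ← mul_add, ← card_union_of_disjoint]
  · congr 2
    ext x
    simp only [mem_hBall, mem_union, mem_shell, mem_filter]
    rw [dd_erase hi]
    split_ifs with h1
    · simp only [h1, and_true]; omega
    · simp only [h1, and_false, or_false]; omega
  · rw [Finset.disjoint_left]
    intro x
    simp only [mem_hBall, mem_shell, mem_filter]
    omega

theorem arith_aux1 (k s : ℕ) :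
    4 * ((k + 2) * (k + 1 + s + 2)) ≤
      3 * ((k + 2) * (k + 1) + (k + 1 + s + 2) * (k + 1 + s + 1)) := by
  have : 3 * ((k + 2) * (k + 1) + (k + 1 + s + 2) * (k + 1 + s + 1)) =
    4 * ((k + 2) * (k + 1 + s + 2)) + (3 * s ^ 2 + 7 * s + 2 * k ^ 2 + 4 * k + 2 * k * s) := by ring
  omega

theorem arith_aux0 (k l : ℕ) (hkl : 1 ≤ k ∨ 1 ≤ l) :
    4 * ((k + 2) * (l + 2)) ≤ 3 * ((k + 2) * (k + 1) + (l + 2) * (l + 1)) := by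
  rcases Nat.lt_trichotomy k l with h | h | h
  · obtain ⟨s, rfl⟩ := Nat.exists_eq_add_of_le h
    exact arith_aux1 k s
  · subst h
    have : 1 ≤ k := by omega
    nlinarith
  · obtain ⟨s, rfl⟩ := Nat.exists_eq_add_of_le h
    have := arith_aux1 l s
    rw [mul_comm (l + 2) (_ + 2), add_comm ((l + 2) * _)] at this
    exact this

theorem arith_aux (k l m a b c d A B : ℕ) (hm : 3 ≤ m)
    (hkl : 1 ≤ k ∨ 1 ≤ l) (hb : 0 < b) (hd : 0 < d)
    (hA : m * A = m * a + b) (hB : m * B = m * c + d)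
    (h1 : (a + b) * c ≤ A * B) (h2 : a * (c + d) ≤ A * B)
    (sa : (k + 1) * b + (if 1 ≤ k then 1 else 0) ≤ (l + 2) * ((m - 1) * a))
    (sc : (l + 1) * d + (if 1 ≤ l then 1 else 0) ≤ (k + 2) * ((m - 1) * c)) : False := by
  obtain ⟨m, rfl⟩ : ∃ q, m = q + 3 := ⟨m - 3, by omega⟩
  have e : m + 3 - 1 = m + 2 := by omega
  rw [e] at sa sc
  have hAB : (m + 3) * (m + 3) * (A * B) = ((m + 3) * a + b) * ((m + 3) * c + d) := by
    rw [← hA, ← hB]; ring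
  have g1 : (m + 3) * (m + 3) * ((a + b) * c) ≤ ((m + 3) * a + b) * ((m + 3) * c + d) := by
    rw [← hAB]; exact Nat.mul_le_mul_left _ h1
  have g2 : (m + 3) * (m + 3) * (a * (c + d)) ≤ ((m + 3) * a + b) * ((m + 3) * c + d) := by
    rw [← hAB]; exact Nat.mul_le_mul_left _ h2
  have g3 : (m + 3) * (m + 1) * (a * d + b * c) ≤ 2 * (b * d) := by nlinarith
  have sa' := Nat.mul_le_mul_left ((k + 2) * d) sa
  have sc' := Nat.mul_le_mul_left ((l + 2) * b) sc
  have strict : ((k + 2) * (k + 1) + (l + 2) * (l + 1)) * (b * d) <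
      (k + 2) * (l + 2) * (m + 2) * (a * d + b * c) := by
    have : 0 < (k + 2) * d * (if 1 ≤ k then 1 else 0) + (l + 2) * b * (if 1 ≤ l then 1 else 0) := by
      rcases hkl with h | h
      · rw [if_pos h]; positivity
      · rw [if_pos h]; positivity
    nlinarith
  have g4 : (m + 3) * (m + 1) * ((k + 2) * (l + 2) * (m + 2) * (a * d + b * c)) ≤
      (k + 2) * (l + 2) * (m + 2) * (2 * (b * d)) := by
    calc _ = (k + 2) * (l + 2) * (m + 2) * ((m + 3) * (m + 1) * (a * d + b * c)) := by ring
      _ ≤ _ := Nat.mul_le_mul_left _ g3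
  have g5 : (m + 3) * (m + 1) * (((k + 2) * (k + 1) + (l + 2) * (l + 1)) * (b * d)) <
      (k + 2) * (l + 2) * (m + 2) * (2 * (b * d)) :=
    lt_of_lt_of_le (Nat.mul_lt_mul_of_pos_left strict (by positivity)) g4
  have g6 : (m + 3) * (m + 1) * ((k + 2) * (k + 1) + (l + 2) * (l + 1)) <
      (k + 2) * (l + 2) * (m + 2) * 2 := by
    refine Nat.lt_of_mul_lt_mul_right (a := b * d) ?_
    calc _ = (m + 3) * (m + 1) * (((k + 2) * (k + 1) + (l + 2) * (l + 1)) * (b * d)) := by ring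
      _ < _ := g5
      _ = _ := by ring
  have g7 := arith_aux0 k l hkl
  have g8 : 3 * (m + 2) ≤ 2 * ((m + 3) * (m + 1)) := by
    have : 2 * ((m + 3) * (m + 1)) = 3 * (m + 2) + (2 * m ^ 2 + 5 * m) := by ring
    omega
  have g9 := Nat.mul_le_mul g7 g8
  generalize (k + 2) * (k + 1) + (l + 2) * (l + 1) = Y at g6 g9
  generalize (k + 2) * (l + 2) = X at g6 g9
  generalize hZ : (m + 3) * (m + 1) = Z at g6 g9
  have e1 : 4 * X * (3 * (m + 2)) = 6 * (X * (m + 2) * 2) := by ring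
  have e2 : 3 * Y * (2 * Z) = 6 * (Z * Y) := by ring
  omega

theorem not_max_one (hp : ∀ i, 3 ≤ p i) {T : Finset (Fin n)} {x₀ : ∀ i, Fin (p i)}
    (hT : T.card = 3) (h : MaxPair 1 (hBall T x₀ 1) (hBall T x₀ 1)) : False := by
  obtain ⟨c, hc, hmin⟩ := Finset.exists_min_image T p (card_pos.mp (by omega))
  have h2 : (T.erase c).card = 2 := by rw [card_erase_of_mem hc, hT]
  obtain ⟨i, j, hij, hTe⟩ := Finset.card_eq_two.mp h2
  have hiT : i ∈ T.erase c := by rw [hTe]; simp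
  have hjT : j ∈ T.erase c := by rw [hTe]; simp
  rw [mem_erase] at hiT hjT
  have hT3 : T = {c, i, j} := by rw [← Finset.insert_erase hc, hTe]
  let D : Fin n → Finset (∀ i, Fin (p i)) := fun i => univ.filter (fun x => x i = x₀ i)
  have hX : ∀ u v, u ≠ v → p u * ((D v).filter (fun x => x u = x₀ u)).card = (D v).card := by
    intro u v huv
    refine card_coord u (x₀ u) ?_
    intro x hx w
    simp only [D, mem_filter, mem_univ, true_and] at hx ⊢
    rwa [Function.update_of_ne huv.symm]
  have hD : ∀ v, p v * (D v).card = (univ : Finset (∀ i, Fin (p i))).card := by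
    intro v
    exact card_coord v (x₀ v) (by simp)
  have x1 := hX i c hiT.1
  have x2 := hX j c hjT.1
  have x3 := hX j i hij.symm
  have d1 := hD c
  have d2 := hD i
  set X1 := (D c).filter (fun x => x i = x₀ i) with hX1
  set X2 := (D c).filter (fun x => x j = x₀ j) with hX2
  set X3 := (D i).filter (fun x => x j = x₀ j) with hX3
  have hsub : hBall T x₀ 1 ⊆ (X1 ∪ X2) ∪ X3 := by
    intro x hx
    rw [mem_hBall, dd_erase hc, dd_erase (i := i) (by simp [hiT]), dd_erase (i := j)
      (by simp [hjT, hij.symm])] at hx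
    simp only [hX1, hX2, hX3, D, mem_union, mem_filter, mem_univ, true_and]
    by_cases e1 : x c = x₀ c <;> by_cases e2 : x i = x₀ i <;> by_cases e3 : x j = x₀ j <;>
      simp [e1, e2, e3] at hx ⊢
  have u1 := card_le_card hsub
  have u2 := card_union_le (X1 ∪ X2) X3
  have u3 := card_union_add_card_inter X1 X2
  have u4 : 0 < (X1 ∩ X2).card := card_pos.mpr ⟨x₀, by simp [hX1, hX2, D]⟩
  have hDi : (D i).card ≤ (D c).card := by
    have h3 := hmin i hiT.2
    have h4 := hp c
    by_contra hlt
    push Not at hlt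
    have : p c * (D c).card < p i * (D i).card :=
      Nat.mul_lt_mul_of_le_of_lt h3 hlt (by omega)
    omega
  have v1 : 3 * X1.card ≤ (D c).card := by rw [← x1]; exact Nat.mul_le_mul_right _ (hp i)
  have v2 : 3 * X2.card ≤ (D c).card := by rw [← x2]; exact Nat.mul_le_mul_right _ (hp j)
  have v3 : 3 * X3.card ≤ (D i).card := by rw [← x3]; exact Nat.mul_le_mul_right _ (hp j)
  have hlt : (hBall T x₀ 1).card < (D c).card := by omega
  have hbad := h.2 (D c) (D c) (by
    intro x hx y hy
    simp only [D, mem_filter, mem_univ, true_and] at hx hy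
    exact card_pos.mpr ⟨c, by simp [hx, hy]⟩)
  have := Nat.mul_lt_mul'' hlt hlt
  omega

theorem not_max {k l : ℕ} (hp : ∀ i, 3 ≤ p i) {T : Finset (Fin n)} {x₀ : ∀ i, Fin (p i)}
    (hT : (k + 1) + (l + 1) + 1 = T.card)
    (h : MaxPair 1 (hBall T x₀ (k + 1)) (hBall T x₀ (l + 1))) : False := by
  by_cases hkl : 1 ≤ k ∨ 1 ≤ l
  · obtain ⟨i, hi, hmax⟩ := Finset.exists_max_image T p (card_pos.mp (by omega))
    have hc : (T.erase i).card = k + l + 2 := by rw [card_erase_of_mem hi]; omega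
    have hM : ∀ j ∈ T.erase i, p j ≤ p i := fun j hj => hmax j (mem_of_mem_erase hj)
    have a1 := h.2 _ _ (crossInt_balls (r := 1) (k := k + 1) (l := l) (T := T.erase i) x₀ (by omega))
    have a2 := h.2 _ _ (crossInt_balls (r := 1) (k := k) (l := l + 1) (T := T.erase i) x₀ (by omega))
    rw [ball_card_succ] at a1 a2
    have hstr : ∀ k s, (k + 1) + s + 1 = (T.erase i).card →
        (k + 1) * (shell (T.erase i) x₀ (k + 1)).card + (if 1 ≤ k then 1 else 0) ≤
        (s + 2) * ((p i - 1) * (hBall (T.erase i) x₀ k).card) := by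
      intro k s hks
      have g1 := shell_ineq x₀ hM k (s + 2) (by omega)
      have hpi := hp i
      rcases k with _ | k
      · have : (shell (T.erase i) x₀ 0).card ≤ (hBall (T.erase i) x₀ 0).card := by
          refine card_le_card fun x => ?_
          rw [mem_shell, mem_hBall]; omega
        have g2 := Nat.mul_le_mul_left (s + 2) (Nat.mul_le_mul_left (p i - 1) this)
        simp only [zero_add] at g1 ⊢
        simpa using g1.trans g2
      · rw [if_pos (by omega), ball_card_succ]
        have g3 : 0 < (hBall (T.erase i) x₀ k).card :=
          card_pos.mpr ⟨x₀, by rw [mem_hBall]; simp [dd]⟩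
        have g4 : 0 < (s + 2) * ((p i - 1) * (hBall (T.erase i) x₀ k).card) := by
          have : 0 < p i - 1 := by omega
          positivity
        rw [mul_add, mul_add]
        omega
    exact arith_aux k l (p i) _ _ _ _ _ _ (hp i) hkl
      (shell_nonempty hp x₀ (by omega)) (shell_nonempty hp x₀ (by omega))
      (ball_card_erase x₀ k hi) (ball_card_erase x₀ l hi) a1 a2
      (hstr k l (by omega)) (hstr l k (by omega))
  · have hk : k = 0 := by omega
    have hl : l = 0 := by omega
    subst hk; subst hl
    exact not_max_one hp hT.symm h


theorem both_mem {i : Fin n} {a b : Fin (p i)} (hab : a ≠ b) {A : Finset (∀ i, Fin (p i))}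
    {x : ∀ i, Fin (p i)} (h1 : x ∈ sh i a b A) (h2 : sw i a b x ∈ sh i a b A) : x ∈ A := by
  rw [mem_sh] at h1 h2
  rw [sw_sw, sw_same] at h2
  by_cases hb : x i = b
  · have : x i ≠ a := fun h => hab (h.symm.trans hb)
    tauto
  · by_cases ha : x i = a
    · rw [ha, Equiv.swap_apply_left] at h2
      have : b ≠ a := hab.symm
      tauto
    · tauto

theorem sh_eq_of_closed {i : Fin n} {a b : Fin (p i)} (hab : a ≠ b)
    {A : Finset (∀ i, Fin (p i))}
    (h : ∀ x ∈ sh i a b A, sw i a b x ∈ sh i a b A) : sh i a b A = A :=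
  Finset.eq_of_subset_of_card_le (fun x hx => both_mem hab hx (h x hx)) (card_sh hab A).ge

theorem dd_sw {T : Finset (Fin n)} {i : Fin n} (a b : Fin (p i)) (x₀ x : ∀ i, Fin (p i))
    (h : ¬ (i ∈ T ∧ (x₀ i = a ∨ x₀ i = b))) : dd T x₀ (sw i a b x) = dd T x₀ x := by
  unfold dd
  congr 1
  refine Finset.filter_congr fun j hj => ?_
  by_cases hji : j = i
  · subst hji
    have h1 : x₀ j ≠ a ∧ x₀ j ≠ b := by tauto
    rw [sw_same]
    have h2 : Equiv.swap a b (x₀ j) = x₀ j := Equiv.swap_apply_of_ne_of_ne h1.1 h1.2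
    conv_lhs => rw [← h2]
    simp
  · rw [sw_ne _ _ _ _ hji]

section facts

variable {i : Fin n} {a b : Fin (p i)} {A : Finset (∀ i, Fin (p i))}
  {T : Finset (Fin n)} {x₀ : ∀ i, Fin (p i)} {k : ℕ}

theorem fact0 (hi : i ∈ T) (hA : sh i a b A = hBall T x₀ k) (x : ∀ i, Fin (p i)) :
    x ∈ sh i a b A ↔ dd (T.erase i) x₀ x + (if x i = x₀ i then 0 else 1) ≤ k := by
  rw [hA, mem_hBall, dd_erase hi]

theorem dd_sw_erase (x : ∀ i, Fin (p i)) :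
    dd (T.erase i) x₀ (sw i a b x) = dd (T.erase i) x₀ x :=
  dd_update (notMem_erase i T) _ _ _

theorem fact1 (hab : a ≠ b) (hi : i ∈ T) (hA : sh i a b A = hBall T x₀ k)
    (x : ∀ i, Fin (p i)) (h : dd (T.erase i) x₀ x < k) : x ∈ A := by
  refine both_mem hab ?_ ?_
  · rw [fact0 hi hA]; split_ifs <;> omega
  · rw [fact0 hi hA, dd_sw_erase]; split_ifs <;> omega

theorem fact2 (hi : i ∈ T) (hA : sh i a b A = hBall T x₀ k)
    (x : ∀ i, Fin (p i)) (h : k < dd (T.erase i) x₀ x) : x ∉ A := by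
  intro hx
  by_cases h1 : x ∈ sh i a b A
  · rw [fact0 hi hA] at h1; omega
  · have h2 := sdiff_sh_val hx h1
    have h3 : sw i a b x ∈ sh i a b A := by
      rw [mem_sh, sw_sw, sw_same, h2.1, Equiv.swap_apply_right]
      exact Or.inr ⟨rfl, hx⟩
    rw [fact0 hi hA, dd_sw_erase] at h3
    omega

theorem fact3 (hi : i ∈ T) (hx₀ : x₀ i = a ∨ x₀ i = b) (hA : sh i a b A = hBall T x₀ k)
    (x : ∀ i, Fin (p i)) (h : dd (T.erase i) x₀ x = k) (ha : x i ≠ a) (hb : x i ≠ b) :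
    x ∉ A := by
  intro hx
  have h1 : x ∈ sh i a b A := by rw [mem_sh]; tauto
  have h2 : x i ≠ x₀ i := by
    rcases hx₀ with h | h <;> rwa [h]
  rw [fact0 hi hA, if_neg h2] at h1
  omega

theorem fact4 (hab : a ≠ b) (hi : i ∈ T) (hx₀ : x₀ i = a ∨ x₀ i = b)
    (hA : sh i a b A = hBall T x₀ k)
    (x : ∀ i, Fin (p i)) (h : dd (T.erase i) x₀ x = k) :
    Function.update x i a ∈ A ↔ Function.update x i b ∉ A := by
  have e1 : sw i a b (Function.update x i a) = Function.update x i b := by simp [sw]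
  have e2 : sw i a b (Function.update x i b) = Function.update x i a := by simp [sw]
  have u1 := fact0 hi hA (Function.update x i a)
  have u2 := fact0 hi hA (Function.update x i b)
  rw [mem_sh, e1, dd_update (notMem_erase i T), h] at u1
  rw [mem_sh, e2, dd_update (notMem_erase i T), h] at u2
  simp only [Function.update_self] at u1 u2
  have hba := hab.symm
  rcases hx₀ with h0 | h0
  · rw [h0] at u1 u2
    simp only [hab, hba, if_true, if_false] at u1 u2
    have n1 : ¬ (k + 1 ≤ k) := by omega
    have n2 : k + 0 ≤ k := by omega
    tauto
  · rw [h0] at u1 u2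
    simp only [hab, hba, if_true, if_false] at u1 u2
    have n1 : ¬ (k + 1 ≤ k) := by omega
    have n2 : k + 0 ≤ k := by omega
    tauto

end facts

/-- the disagreement set -/
def ds (T : Finset (Fin n)) (x₀ x : ∀ i, Fin (p i)) : Finset (Fin n) :=
  T.filter (fun i => x i ≠ x₀ i)

theorem mem_ds {T : Finset (Fin n)} {x₀ x : ∀ i, Fin (p i)} {j : Fin n} :
    j ∈ ds T x₀ x ↔ j ∈ T ∧ x j ≠ x₀ j := by simp [ds]

theorem link_aux {r k l : ℕ} {i : Fin n} {a b : Fin (p i)} (hab : a ≠ b)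
    {A B : Finset (∀ i, Fin (p i))} (h : CrossInt r A B)
    {T : Finset (Fin n)} {x₀ : ∀ i, Fin (p i)} (hi : i ∈ T) (hkl : k + l + r = T.card)
    (hr : 1 ≤ r) {x y : ∀ i, Fin (p i)}
    (hx : (ds (T.erase i) x₀ x).card = k) (hy : (ds (T.erase i) x₀ y).card = l)
    (hxy : Disjoint (ds (T.erase i) x₀ x) (ds (T.erase i) x₀ y))
    (hT : ∀ j, j ∉ T → x j ≠ y j)
    (hxA : Function.update x i a ∈ A) (hyB : Function.update y i b ∈ B) : False := by
  have h1 := h _ hxA _ hyB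
  have h2 : univ.filter (fun j => Function.update x i a j = Function.update y i b j) ⊆
      (T.erase i) \ (ds (T.erase i) x₀ x ∪ ds (T.erase i) x₀ y) := by
    intro j
    simp only [mem_filter, mem_univ, true_and, mem_sdiff, mem_union, mem_erase]
    intro hj
    by_cases hji : j = i
    · subst hji; simp [hab] at hj
    · simp only [ne_eq, hji, not_false_eq_true, Function.update_of_ne] at hj
      have hjT : j ∈ T := by
        by_contra hjT; exact hT j hjT hj
      have : j ∈ _ → j ∉ _ := fun hh => Finset.disjoint_left.mp hxy hh
      rw [mem_ds, mem_ds, mem_erase, ← hj] at this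
      rw [mem_ds, mem_ds, mem_erase, ← hj]
      tauto
  have h3 := card_le_card h2
  have hsub : ds (T.erase i) x₀ x ∪ ds (T.erase i) x₀ y ⊆ T.erase i :=
    union_subset (filter_subset _ _) (filter_subset _ _)
  rw [card_sdiff_of_subset hsub,
    card_union_of_disjoint hxy, card_erase_of_mem hi, hx, hy] at h3
  omega

theorem step {r k l : ℕ} (hp : ∀ i, 3 ≤ p i) {i : Fin n} {a b : Fin (p i)} (hab : a ≠ b)
    {A B : Finset (∀ i, Fin (p i))} (h : CrossInt r A B)
    {T : Finset (Fin n)} {x₀ : ∀ i, Fin (p i)} (hi : i ∈ T) (hkl : k + l + r = T.card)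
    (hr : 1 ≤ r) (hx₀ : x₀ i = a ∨ x₀ i = b)
    (hA : sh i a b A = hBall T x₀ k) (hB : sh i a b B = hBall T x₀ l)
    {x x' : ∀ i, Fin (p i)}
    (hx : (ds (T.erase i) x₀ x).card = k) (hx' : (ds (T.erase i) x₀ x').card = k)
    (hu : (ds (T.erase i) x₀ x ∪ ds (T.erase i) x₀ x').card + l ≤ (T.erase i).card) :
    Function.update x i a ∈ A ↔ Function.update x' i a ∈ A := by
  have hs := Finset.le_card_sdiff (ds (T.erase i) x₀ x ∪ ds (T.erase i) x₀ x') (T.erase i)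
  obtain ⟨W, hWs, hW⟩ := Finset.exists_subset_card_eq
    (s := T.erase i \ (ds (T.erase i) x₀ x ∪ ds (T.erase i) x₀ x')) (n := l) (by omega)
  choose o ho using fun j => exists_ne2 hp j (x₀ j) (x₀ j)
  choose c hc using fun j => exists_ne2 hp j (x j) (x' j)
  let y : ∀ i, Fin (p i) := fun j => if j ∈ T then (if j ∈ W then o j else x₀ j) else c j
  have hyW : ds (T.erase i) x₀ y = W := by
    ext j
    rw [mem_ds]
    constructor
    · rintro ⟨h1, h2⟩
      by_contra hj
      exact h2 (by simp [y, mem_of_mem_erase h1, hj])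
    · intro hj
      have h1 := (mem_sdiff.mp (hWs hj)).1
      refine ⟨h1, ?_⟩
      simp [y, mem_of_mem_erase h1, hj, (ho j).1]
  have hyl : (ds (T.erase i) x₀ y).card = l := by rw [hyW, hW]
  have hd1 : Disjoint (ds (T.erase i) x₀ x) (ds (T.erase i) x₀ y) := by
    rw [hyW, Finset.disjoint_left]
    intro j h1 h2
    exact (mem_sdiff.mp (hWs h2)).2 (mem_union_left _ h1)
  have hd2 : Disjoint (ds (T.erase i) x₀ x') (ds (T.erase i) x₀ y) := by
    rw [hyW, Finset.disjoint_left]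
    intro j h1 h2
    exact (mem_sdiff.mp (hWs h2)).2 (mem_union_right _ h1)
  have ho1 : ∀ j, j ∉ T → x j ≠ y j := fun j hj => by
    simp only [y, hj, if_false]; exact (hc j).1.symm
  have ho2 : ∀ j, j ∉ T → x' j ≠ y j := fun j hj => by
    simp only [y, hj, if_false]; exact (hc j).2.symm
  have fB := fact4 hab hi hx₀ hB y hyl
  have key : ∀ z : ∀ i, Fin (p i), (ds (T.erase i) x₀ z).card = k →
      Disjoint (ds (T.erase i) x₀ z) (ds (T.erase i) x₀ y) →
      (∀ j, j ∉ T → z j ≠ y j) →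
      (Function.update z i a ∈ A ↔ Function.update y i a ∈ B) := by
    intro z hz hd hoz
    have fA := fact4 hab hi hx₀ hA z hz
    have l1 := link_aux hab h hi hkl hr hz hyl hd hoz
    have l2 := link_aux hab.symm h hi hkl hr hz hyl hd hoz
    tauto
  rw [key x hx hd1 ho1, key x' hx' hd2 ho2]

theorem chain {r k l : ℕ} (hp : ∀ i, 3 ≤ p i) {i : Fin n} {a b : Fin (p i)} (hab : a ≠ b)
    {A B : Finset (∀ i, Fin (p i))} (h : CrossInt r A B)
    {T : Finset (Fin n)} {x₀ : ∀ i, Fin (p i)} (hi : i ∈ T) (hkl : k + l + r = T.card)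
    (hr : 2 ≤ r) (hx₀ : x₀ i = a ∨ x₀ i = b)
    (hA : sh i a b A = hBall T x₀ k) (hB : sh i a b B = hBall T x₀ l)
    {x' : ∀ i, Fin (p i)} (hx' : (ds (T.erase i) x₀ x').card = k) (m : ℕ) :
    ∀ x : ∀ i, Fin (p i), (ds (T.erase i) x₀ x).card = k →
      (ds (T.erase i) x₀ x' \ ds (T.erase i) x₀ x).card = m →
      (Function.update x i a ∈ A ↔ Function.update x' i a ∈ A) := by
  have hTe : (T.erase i).card + 1 = k + l + r := by
    rw [hkl]; exact Finset.card_erase_add_one hi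
  induction m with
  | zero =>
    intro x hx hm
    refine step hp hab h hi hkl (by omega) hx₀ hA hB hx hx' ?_
    rw [card_eq_zero, sdiff_eq_empty_iff_subset] at hm
    rw [Finset.union_eq_left.mpr hm]
    omega
  | succ m ih =>
    intro x hx hm
    obtain ⟨v, hv⟩ := card_pos.mp (by omega :
      0 < (ds (T.erase i) x₀ x' \ ds (T.erase i) x₀ x).card)
    have hcomm := Finset.card_sdiff_comm (hx.trans hx'.symm)
    obtain ⟨u, hu⟩ := card_pos.mp (by omega :
      0 < (ds (T.erase i) x₀ x \ ds (T.erase i) x₀ x').card)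
    rw [mem_sdiff] at hu hv
    have hvx' := mem_ds.mp hv.1
    have huv : u ≠ v := by rintro rfl; exact hv.2 hu.1
    let z : ∀ i, Fin (p i) := Function.update (Function.update x u (x₀ u)) v (x' v)
    have hz : ds (T.erase i) x₀ z = insert v ((ds (T.erase i) x₀ x).erase u) := by
      ext j
      rw [mem_insert, mem_erase, mem_ds, mem_ds]
      by_cases hjv : j = v
      · subst hjv; simp [z, hvx'.2]; simpa using hvx'.1
      · by_cases hju : j = u
        · subst hju; simp [z, hjv]
        · simp [z, hjv, hju]
    have hzk : (ds (T.erase i) x₀ z).card = k := by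
      rw [hz, card_insert_of_notMem (fun hh => hv.2 (mem_of_mem_erase hh)),
        card_erase_add_one hu.1, hx]
    have hzm : (ds (T.erase i) x₀ x' \ ds (T.erase i) x₀ z).card = m := by
      have : ds (T.erase i) x₀ x' \ ds (T.erase i) x₀ z =
          (ds (T.erase i) x₀ x' \ ds (T.erase i) x₀ x).erase v := by
        rw [hz]
        ext j
        simp only [mem_sdiff, mem_insert, mem_erase]
        by_cases hju : j = u
        · subst hju; tauto
        · tauto
      rw [this, card_erase_of_mem (mem_sdiff.mpr hv), hm]
      rfl
    rw [← ih z hzk hzm]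
    refine step hp hab h hi hkl (by omega) hx₀ hA hB hx hzk ?_
    have hsub : ds (T.erase i) x₀ x ∪ ds (T.erase i) x₀ z ⊆ insert v (ds (T.erase i) x₀ x) := by
      rw [hz]
      intro j
      simp only [mem_union, mem_insert, mem_erase]
      tauto
    have h1 := card_le_card hsub
    have h2 := card_insert_le v (ds (T.erase i) x₀ x)
    omega

theorem isBall_of_sh {r : ℕ} (hr : 1 ≤ r) (hrn : r ≤ n) (hp : ∀ i, 3 ≤ p i)
    {i : Fin n} {a b : Fin (p i)} (hab : a ≠ b)
    {A B : Finset (∀ i, Fin (p i))} (h : MaxPair r A B) (hball : IsBall (sh i a b A)) :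
    IsBall A := by
  classical
  have h' := maxPair_sh hab h
  obtain ⟨T, x₀, k, hA⟩ := hball
  by_cases hc : i ∈ T ∧ (x₀ i = a ∨ x₀ i = b)
  swap
  · have : sh i a b A = A := by
      refine sh_eq_of_closed hab fun x hx => ?_
      rw [hA, mem_hBall] at hx ⊢
      rwa [dd_sw _ _ _ _ hc]
    exact ⟨T, x₀, k, by rw [← this, hA]⟩
  obtain ⟨hi, hx₀⟩ := hc
  rw [hA] at h'
  obtain ⟨l, hkl, hB⟩ := ball_partner hr hrn hp h'
  rw [hB] at h'
  have hTe : (T.erase i).card + 1 = k + l + r := by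
    rw [hkl]; exact Finset.card_erase_add_one hi
  have hconst : ∀ x x' : ∀ i, Fin (p i), dd (T.erase i) x₀ x = k → dd (T.erase i) x₀ x' = k →
      (Function.update x i a ∈ A ↔ Function.update x' i a ∈ A) := by
    intro x x' hx hx'
    by_cases hr2 : 2 ≤ r
    · exact chain hp hab h.1 hi hkl hr2 hx₀ hA hB hx' _ x hx rfl
    · have hr1 : r = 1 := by omega
      subst hr1
      refine step hp hab h.1 hi hkl hr hx₀ hA hB hx hx' ?_
      rcases k with _ | k
      · have := card_union_le (ds (T.erase i) x₀ x) (ds (T.erase i) x₀ x')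
        unfold dd at hx hx'
        unfold ds at this ⊢
        omega
      · rcases l with _ | l
        · exact card_le_card (union_subset (filter_subset _ _) (filter_subset _ _))
        · exact (not_max hp hkl h').elim
  let c : ∀ i, Fin (p i) := Function.update x₀ i
    (if ∃ x, dd (T.erase i) x₀ x = k ∧ Function.update x i a ∈ A then a else b)
  refine ⟨T, c, k, ?_⟩
  ext x
  have hdc : dd (T.erase i) c x = dd (T.erase i) x₀ x := by
    unfold dd
    congr 1
    refine Finset.filter_congr fun j hj => ?_
    simp [c, ne_of_mem_erase hj]
  rw [mem_hBall, dd_erase hi, hdc]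
  rcases Nat.lt_trichotomy (dd (T.erase i) x₀ x) k with hlt | heq | hgt
  · have := fact1 hab hi hA x hlt
    simp only [this, true_iff]
    split_ifs <;> omega
  · have e : dd (T.erase i) x₀ x + (if x i = c i then 0 else 1) ≤ k ↔ x i = c i := by
      split_ifs with h1
      · simp only [h1, iff_true]; omega
      · simp only [h1, iff_false]; omega
    rw [e]
    have f4 := fact4 hab hi hx₀ hA x heq
    by_cases hex : ∃ x, dd (T.erase i) x₀ x = k ∧ Function.update x i a ∈ A
    · have hci : c i = a := by simp only [c, Function.update_self, if_pos hex]
      obtain ⟨w, hw, hwA⟩ := hex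
      have hP := (hconst w x hw heq).mp hwA
      rw [hci]
      constructor
      · intro hx
        by_contra hxa
        by_cases hxb : x i = b
        · have : Function.update x i b = x := by rw [← hxb, Function.update_eq_self]
          rw [this] at f4
          exact f4.mp hP hx
        · exact fact3 hi hx₀ hA x heq hxa hxb hx
      · intro hxa
        have : Function.update x i a = x := by rw [← hxa, Function.update_eq_self]
        rwa [this] at hP
    · have hci : c i = b := by simp only [c, Function.update_self, if_neg hex]
      have hP : Function.update x i a ∉ A := fun hh => hex ⟨x, heq, hh⟩
      rw [hci]
      constructor
      · intro hx
        by_contra hxb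
        by_cases hxa : x i = a
        · have : Function.update x i a = x := by rw [← hxa, Function.update_eq_self]
          rw [this] at hP
          exact hP hx
        · exact fact3 hi hx₀ hA x heq hxa hxb hx
      · intro hxb
        have : Function.update x i b = x := by rw [← hxb, Function.update_eq_self]
        rw [this] at f4
        tauto
  · have := fact2 hi hA x hgt
    simp only [this, false_iff]
    omega

theorem suppv_card_sw (z : ∀ i, Fin (p i)) (hz : ∀ i, (z i : ℕ) = 0) {i : Fin n}
    {b : Fin (p i)} (hb : b ≠ z i) (x : ∀ i, Fin (p i)) (hx : x i = b) :
    (suppv (sw i (z i) b x)).card < (suppv x).card := by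
  refine card_lt_card ?_
  rw [Finset.ssubset_iff_of_subset]
  · refine ⟨i, ?_, ?_⟩
    · simp only [suppv, mem_filter, mem_univ, true_and, hx]
      rw [Nat.pos_iff_ne_zero]
      intro h0
      exact hb (Fin.ext (by rw [h0, hz]))
    · simp [suppv, sw_same, hx, hz]
  · intro j
    simp only [suppv, mem_filter, mem_univ, true_and]
    by_cases hj : j = i
    · subst hj; simp [sw_same, hx, hz]
    · rw [sw_ne _ _ _ _ hj]; exact id

end Sol

open scoped Classical in
/-- Lemma 10, second part: if `p_i ≥ 3` for all `i` and `(A, B)` is a maximal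
`r`-cross-intersecting pair such that `A` and `B` are not balls, then there is
a maximal `r`-cross-intersecting pair `(A', B')` of monotone families that are
not balls, with no more relevant coordinates than `A`. -/
theorem lemma10_part2 {n : ℕ} (r : ℕ) (hr : 1 ≤ r) (hrn : r ≤ n)
    (p : Fin n → ℕ) (hp : ∀ i, 3 ≤ p i)
    (A B : Finset (∀ i, Fin (p i))) (hAB : MaxPair r A B)
    (hA : ¬ IsBall A) (hB : ¬ IsBall B) :
    ∃ A' B' : Finset (∀ i, Fin (p i)),
      MaxPair r A' B' ∧ MonotoneFam A' ∧ MonotoneFam B' ∧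
      ¬ IsBall A' ∧ ¬ IsBall B' ∧
      (univ.filter (fun i => Relevant A' i)).card ≤
        (univ.filter (fun i => Relevant A i)).card := by
  let z : ∀ i, Fin (p i) := fun i => ⟨0, by have := hp i; omega⟩
  have hz : ∀ i, (z i : ℕ) = 0 := fun i => rfl
  let w : Finset (∀ i, Fin (p i)) → ℕ := fun C => ∑ x ∈ C, (suppv x).card
  let F : Finset (Finset (∀ i, Fin (p i)) × Finset (∀ i, Fin (p i))) :=
    univ.filter (fun q => MaxPair r q.1 q.2 ∧ ¬ IsBall q.1 ∧ ¬ IsBall q.2 ∧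
      (univ.filter (fun i => Relevant q.1 i)).card ≤ (univ.filter (fun i => Relevant A i)).card)
  have hF : F.Nonempty := ⟨(A, B), by simp only [F, mem_filter, mem_univ, true_and]; exact ⟨hAB, hA, hB, le_rfl⟩⟩
  obtain ⟨⟨A', B'⟩, hq, hmin⟩ := Finset.exists_min_image F (fun q => w q.1 + w q.2) hF
  simp only [F, mem_filter, mem_univ, true_and] at hq
  obtain ⟨hmax, hA', hB', hrel⟩ := hq
  have hclosed : ∀ i b, b ≠ z i → Sol.sh i (z i) b A' = A' ∧ Sol.sh i (z i) b B' = B' := by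
    intro i b hb
    have hmem : (Sol.sh i (z i) b A', Sol.sh i (z i) b B') ∈ F := by
      simp only [F, mem_filter, mem_univ, true_and]
      refine ⟨Sol.maxPair_sh hb.symm hmax,
        fun h => hA' (Sol.isBall_of_sh hr hrn hp hb.symm hmax h),
        fun h => hB' (Sol.isBall_of_sh hr hrn hp hb.symm (Sol.maxPair_symm hmax) h), ?_⟩
      refine le_trans (card_le_card ?_) hrel
      intro j
      simp only [mem_filter, mem_univ, true_and]
      exact Sol.relevant_sh
    have h1 := hmin _ hmem
    have h2 := Sol.sum_sh_lt hb.symm A' (fun x => (suppv x).card) (Sol.suppv_card_sw z hz hb)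
    have h3 := Sol.sum_sh_lt hb.symm B' (fun x => (suppv x).card) (Sol.suppv_card_sw z hz hb)
    simp only [w] at h1
    constructor
    · by_contra hne
      have := h2.2 hne
      omega
    · by_contra hne
      have := h3.2 hne
      omega
  exact ⟨A', B', hmax,
    Sol.monotone_of_closed hrn hmax z hz fun i b hb => (hclosed i b hb).2,
    Sol.monotone_of_closed hrn (Sol.maxPair_symm hmax) z hz fun i b hb => (hclosed i b hb).1,
    hA', hB', hrel⟩
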